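/- Let I, J ⊆ ℝ be nonempty open intervals, let γ, β : I → ℝ³ be smooth with β'(s) ≠ 0 for all s ∈ I, let δ ∈ {−1,1} be a constant with ⟨β(s),β(s)⟩ = δ and ⟨β(s),γ'(s)⟩ = 0 for all s ∈ I, and let V ∈ ℝ³. Suppose that for every s ∈ I and every t ∈ J the ruled surface X(s,t) = γ(s) + t·β(s) is nondegenerate (EG − F² ≠ 0) and satisfies the translating soliton equation (★). Then δ = 1 (β is spacelike), ⟨β'(s),β'(s)⟩ = 0 for all s ∈ I, and the trace of β is a straight line with lightlike direction: there exist vectors a, b ∈ ℝ³ with a ≠ 0, ⟨a,a⟩ = 0, ⟨a,b⟩ = 0, ⟨b,b⟩ = 1, and a smooth function f : I → ℝ with f'(s) ≠ 0 for all s, such that β(s) = b + f(s)·a for all s ∈ I. -/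

import Mathlib

noncomputable section

open Real

/-- The Lorentzian inner product on `𝕃³ = ℝ³`: `⟨x,y⟩ = x₁y₁ + x₂y₂ − x₃y₃`. -/
def Lprod (u v : Fin 3 → ℝ) : ℝ := u 0 * v 0 + u 1 * v 1 - u 2 * v 2

/-- The mixed product `(u,v,w) = det(u,v,w)`. -/
def mixed (u v w : Fin 3 → ℝ) : ℝ :=
  u 0 * (v 1 * w 2 - v 2 * w 1) - u 1 * (v 0 * w 2 - v 2 * w 0) +
    u 2 * (v 0 * w 1 - v 1 * w 0)

/-- `X_s = γ' + t β'` for the ruled surface `X(s,t) = γ(s) + t β(s)`. -/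
def Xs (γ β : ℝ → Fin 3 → ℝ) (s t : ℝ) : Fin 3 → ℝ := deriv γ s + t • deriv β s

/-- `X_ss = γ'' + t β''`. -/
def Xss (γ β : ℝ → Fin 3 → ℝ) (s t : ℝ) : Fin 3 → ℝ :=
  deriv (deriv γ) s + t • deriv (deriv β) s

/-- Nondegeneracy at `(s,t)`: `EG − F² ≠ 0`. -/
def Nondeg (γ β : ℝ → Fin 3 → ℝ) (s t : ℝ) : Prop :=
  Lprod (Xs γ β s t) (Xs γ β s t) * Lprod (β s) (β s) -
      (Lprod (Xs γ β s t) (β s)) ^ 2 ≠ 0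

/-- The translating soliton equation (★) of the IMCF at `(s,t)`:
`(X_s,X_t,V)·[G·(X_s,X_t,X_ss) − 2F·(X_s,X_t,X_st)] = 2(EG − F²)²`,
where `X_t = β` and `X_st = β'`. -/
def SolitonEq (γ β : ℝ → Fin 3 → ℝ) (V : Fin 3 → ℝ) (s t : ℝ) : Prop :=
  mixed (Xs γ β s t) (β s) V *
      (Lprod (β s) (β s) * mixed (Xs γ β s t) (β s) (Xss γ β s t) -
        2 * Lprod (Xs γ β s t) (β s) * mixed (Xs γ β s t) (β s) (deriv β s)) =
    2 * (Lprod (Xs γ β s t) (Xs γ β s t) * Lprod (β s) (β s) -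
          (Lprod (Xs γ β s t) (β s)) ^ 2) ^ 2

/-- A real polynomial of degree at most four vanishing on a nonempty open set has zero
leading coefficient. -/
lemma quartic_leadingCoeff_eq_zero {J : Set ℝ} (hJ : IsOpen J) (hne : J.Nonempty)
    {c₀ c₁ c₂ c₃ c₄ : ℝ}
    (h : ∀ t ∈ J, c₀ + c₁ * t + c₂ * t ^ 2 + c₃ * t ^ 3 + c₄ * t ^ 4 = 0) : c₄ = 0 := by
  obtain ⟨t, ht⟩ := hne
  obtain ⟨ε, hε, hball⟩ := Metric.isOpen_iff.1 hJ t ht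
  have mem : ∀ k : ℝ, 0 ≤ k → k ≤ 4 → t + k * (ε / 5) ∈ J := fun k hk hk' => hball <| by
    rw [Metric.mem_ball, Real.dist_eq, add_sub_cancel_left, abs_of_nonneg (by positivity)]
    nlinarith
  have key : c₄ * (24 * (ε / 5) ^ 4) = 0 := by
    linear_combination h _ (mem 0 (by norm_num) (by norm_num))
      - 4 * h _ (mem 1 (by norm_num) (by norm_num))
      + 6 * h _ (mem 2 (by norm_num) (by norm_num))
      - 4 * h _ (mem 3 (by norm_num) (by norm_num))
      + h _ (mem 4 (by norm_num) (by norm_num))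
  exact (mul_eq_zero.1 key).resolve_right (by positivity)

lemma hasDerivAt_Lprod {u v : ℝ → Fin 3 → ℝ} {u' v' : Fin 3 → ℝ} {s : ℝ}
    (hu : HasDerivAt u u' s) (hv : HasDerivAt v v' s) :
    HasDerivAt (fun x => Lprod (u x) (v x)) (Lprod u' (v s) + Lprod (u s) v') s := by
  rw [hasDerivAt_pi] at hu hv
  refine ((((hu 0).mul (hv 0)).add ((hu 1).mul (hv 1))).sub ((hu 2).mul (hv 2))).congr_deriv ?_
  simp only [Lprod]
  ring

lemma Lprod_comm (u v : Fin 3 → ℝ) : Lprod u v = Lprod v u := by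
  simp only [Lprod]
  ring

/-- If `⟨u, v⟩` is constant on an open set, then `⟨u', v⟩ + ⟨u, v'⟩ = 0` there. -/
lemma Lprod_deriv_add_eq_zero {I : Set ℝ} (hI : IsOpen I) {u v : ℝ → Fin 3 → ℝ} {c s : ℝ}
    {u' v' : Fin 3 → ℝ} (hc : ∀ x ∈ I, Lprod (u x) (v x) = c) (hs : s ∈ I)
    (hu : HasDerivAt u u' s) (hv : HasDerivAt v v' s) :
    Lprod u' (v s) + Lprod (u s) v' = 0 := by
  refine (hasDerivAt_Lprod hu hv).unique ((hasDerivAt_const s c).congr_of_eventuallyEq ?_)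
  filter_upwards [hI.mem_nhds hs] with x hx using hc x hx

/-- A nonzero lightlike vector has nonzero time component. -/
lemma time_ne_zero_of_lightlike {q : Fin 3 → ℝ} (hq : q ≠ 0) (hqq : Lprod q q = 0) :
    q 2 ≠ 0 := by
  intro h2
  simp only [Lprod, h2] at hqq
  apply hq
  ext i
  fin_cases i
  · show q 0 = 0
    nlinarith [sq_nonneg (q 0), sq_nonneg (q 1)]
  · show q 1 = 0
    nlinarith [sq_nonneg (q 0), sq_nonneg (q 1)]
  · exact h2

/-- No nonzero lightlike vector is orthogonal to a unit timelike vector. -/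
lemma not_timelike_of_orthogonal_lightlike {p q : Fin 3 → ℝ} (hq : q ≠ 0)
    (hqq : Lprod q q = 0) (hpq : Lprod p q = 0) : Lprod p p ≠ -1 := by
  intro hpp
  have h2 := time_ne_zero_of_lightlike hq hqq
  simp only [Lprod] at hqq hpq hpp
  have h : (p 0 * q 1 - p 1 * q 0) ^ 2 + q 2 ^ 2 = 0 := by
    linear_combination q 2 ^ 2 * hpp + (p 0 ^ 2 + p 1 ^ 2) * hqq
      - (p 0 * q 0 + p 1 * q 1 + p 2 * q 2) * hpq
  have : 0 < q 2 ^ 2 := by positivity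
  nlinarith [sq_nonneg (p 0 * q 1 - p 1 * q 0)]

/-- Two orthogonal vectors, both orthogonal to a unit spacelike vector, one of them lightlike,
are proportional. -/
lemma proportional_of_orthogonal_lightlike {p q r : Fin 3 → ℝ} (hpp : Lprod p p = 1)
    (hpq : Lprod p q = 0) (hpr : Lprod p r = 0) (hqq : Lprod q q = 0) (hqr : Lprod q r = 0)
    (i : Fin 3) : r i * q 2 = q i * r 2 := by
  have hdet : mixed p q r = 0 := by
    have h : mixed p q r ^ 2 = 0 := by
      have gram : mixed p q r ^ 2 = -(Lprod p p * (Lprod q q * Lprod r r - Lprod q r ^ 2)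
          - Lprod p q * (Lprod p q * Lprod r r - Lprod q r * Lprod p r)
          + Lprod p r * (Lprod p q * Lprod q r - Lprod q q * Lprod p r)) := by
        simp only [mixed, Lprod]
        ring
      rw [gram, hpq, hpr, hqq, hqr]
      ring
    exact pow_eq_zero_iff two_ne_zero |>.1 h
  simp only [mixed, Lprod] at *
  fin_cases i
  · show r 0 * q 2 = q 0 * r 2
    linear_combination (-(r 0 * q 2 - q 0 * r 2)) * hpp + p 1 * hdet
      + (p 2 * r 0 - p 0 * r 2) * hpq - (p 2 * q 0 - p 0 * q 2) * hpr
  · show r 1 * q 2 = q 1 * r 2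
    linear_combination (-(r 1 * q 2 - q 1 * r 2)) * hpp - p 0 * hdet
      + (p 2 * r 1 - p 1 * r 2) * hpq - (p 2 * q 1 - p 1 * q 2) * hpr
  · exact mul_comm _ _

/-- A function with zero derivative on an open interval is constant there. -/
lemma eq_of_hasDerivAt_zero {I : Set ℝ} (hI : IsOpen I) (hconn : I.OrdConnected) {g : ℝ → ℝ}
    (hg : ∀ s ∈ I, HasDerivAt g 0 s) {x y : ℝ} (hx : x ∈ I) (hy : y ∈ I) : g x = g y :=
  hI.is_const_of_deriv_eq_zero hconn.isPreconnected
    (fun s hs => (hg s hs).differentiableAt.differentiableWithinAt)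
    (fun s hs => (hg s hs).deriv) hx hy

/-- In an orthogonal parametrization with unit director, the soliton equation forces `β'` to be
null. -/
lemma Lprod_director_deriv_eq_zero {J : Set ℝ} (hJ : IsOpen J) (hne : J.Nonempty)
    {γ β : ℝ → Fin 3 → ℝ} {δ s : ℝ} {V : Fin 3 → ℝ} (hδ : δ = -1 ∨ δ = 1)
    (hunit : Lprod (β s) (β s) = δ) (horth : Lprod (β s) (deriv γ s) = 0)
    (horth' : Lprod (β s) (deriv β s) = 0) (hsol : ∀ t ∈ J, SolitonEq γ β V s t) :
    Lprod (deriv β s) (deriv β s) = 0 := by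
  have hδ2 : δ ^ 2 = 1 := by rcases hδ with rfl | rfl <;> norm_num
  have hF : ∀ t, Lprod (Xs γ β s t) (β s) = 0 := fun t => by
    simp only [Lprod, Xs, Pi.add_apply, Pi.smul_apply, smul_eq_mul] at *
    linear_combination horth + t * horth'
  set g := deriv γ s
  set b := deriv β s
  set g' := deriv (deriv γ) s
  set b' := deriv (deriv β) s
  set p := β s
  have key := quartic_leadingCoeff_eq_zero hJ hne
    (c₀ := δ * (mixed g p V * mixed g p g') - 2 * Lprod g g ^ 2)
    (c₁ := δ * (mixed b p V * mixed g p g' + mixed g p V * (mixed b p g' + mixed g p b'))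
      - 8 * Lprod g g * Lprod g b)
    (c₂ := δ * (mixed b p V * (mixed b p g' + mixed g p b') + mixed g p V * mixed b p b')
      - 2 * (4 * Lprod g b ^ 2 + 2 * Lprod g g * Lprod b b))
    (c₃ := δ * (mixed b p V * mixed b p b') - 8 * Lprod g b * Lprod b b)
    (c₄ := -2 * Lprod b b ^ 2) fun t ht => by
      have h := hsol t ht
      rw [SolitonEq, hF, hunit] at h
      have hE : Lprod (Xs γ β s t) (Xs γ β s t)
          = Lprod g g + 2 * t * Lprod g b + t ^ 2 * Lprod b b := by
        simp only [Lprod, Xs, Pi.add_apply, Pi.smul_apply, smul_eq_mul, g, b]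
        ring
      have hV : mixed (Xs γ β s t) p V = mixed g p V + t * mixed b p V := by
        simp only [mixed, Xs, Pi.add_apply, Pi.smul_apply, smul_eq_mul, g, b]
        ring
      have hX : mixed (Xs γ β s t) p (Xss γ β s t) = mixed g p g'
          + t * (mixed b p g' + mixed g p b') + t ^ 2 * mixed b p b' := by
        simp only [mixed, Xs, Xss, Pi.add_apply, Pi.smul_apply, smul_eq_mul, g, b, g', b']
        ring
      rw [hE, hV, hX] at h
      linear_combination h
        + 2 * (Lprod g g + 2 * t * Lprod g b + t ^ 2 * Lprod b b) ^ 2 * hδ2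
  exact pow_eq_zero_iff two_ne_zero |>.1 (by linarith)

/-- For a non-cylindrical nondegenerate ruled IMCF translating soliton with
orthogonal parametrization and unit director (`⟨β,β⟩ = δ ∈ {−1,1}`, `⟨β,γ'⟩ = 0`),
one has `δ = 1`, `β'` lightlike, and the trace of `β` is a straight line with
lightlike direction. -/
theorem noncylindrical_director_is_line
    (I J : Set ℝ) (hIopen : IsOpen I) (hIne : I.Nonempty) (hIconn : I.OrdConnected)
    (hJopen : IsOpen J) (hJne : J.Nonempty) (hJconn : J.OrdConnected)
    (γ β : ℝ → Fin 3 → ℝ) (hγ : ContDiffOn ℝ (⊤ : ℕ∞) γ I) (hβ : ContDiffOn ℝ (⊤ : ℕ∞) β I)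
    (hβ' : ∀ s ∈ I, deriv β s ≠ 0)
    (δ : ℝ) (hδ : δ = -1 ∨ δ = 1)
    (hunit : ∀ s ∈ I, Lprod (β s) (β s) = δ)
    (horth : ∀ s ∈ I, Lprod (β s) (deriv γ s) = 0)
    (V : Fin 3 → ℝ)
    (hnd : ∀ s ∈ I, ∀ t ∈ J, Nondeg γ β s t)
    (hsol : ∀ s ∈ I, ∀ t ∈ J, SolitonEq γ β V s t) :
    δ = 1 ∧ (∀ s ∈ I, Lprod (deriv β s) (deriv β s) = 0) ∧
      ∃ (a b : Fin 3 → ℝ) (f : ℝ → ℝ), a ≠ 0 ∧ Lprod a a = 0 ∧ Lprod a b = 0 ∧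
        Lprod b b = 1 ∧ ContDiffOn ℝ (⊤ : ℕ∞) f I ∧ (∀ s ∈ I, deriv f s ≠ 0) ∧
        ∀ s ∈ I, β s = b + f s • a := by
  have hmem {s : ℝ} (hs : s ∈ I) : I ∈ nhds s := hIopen.mem_nhds hs
  have hd1 : ∀ s ∈ I, HasDerivAt β (deriv β s) s := fun s hs =>
    ((hβ.differentiableOn (by simp)).differentiableAt (hmem hs)).hasDerivAt
  have hd2 : ∀ s ∈ I, HasDerivAt (deriv β) (deriv (deriv β) s) s := fun s hs =>
    (((hβ.deriv_of_isOpen (m := 1) hIopen (by norm_cast)).differentiableOn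
      (by simp)).differentiableAt (hmem hs)).hasDerivAt
  have hpq : ∀ s ∈ I, Lprod (β s) (deriv β s) = 0 := fun s hs => by
    have h := Lprod_deriv_add_eq_zero hIopen hunit hs (hd1 s hs) (hd1 s hs)
    rw [Lprod_comm] at h
    linarith
  have hqq : ∀ s ∈ I, Lprod (deriv β s) (deriv β s) = 0 := fun s hs =>
    Lprod_director_deriv_eq_zero hJopen hJne hδ (hunit s hs) (horth s hs) (hpq s hs) (hsol s hs)
  have hqr : ∀ s ∈ I, Lprod (deriv β s) (deriv (deriv β) s) = 0 := fun s hs => by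
    have h := Lprod_deriv_add_eq_zero hIopen hqq hs (hd2 s hs) (hd2 s hs)
    rw [Lprod_comm] at h
    linarith
  have hpr : ∀ s ∈ I, Lprod (β s) (deriv (deriv β) s) = 0 := fun s hs => by
    have h := Lprod_deriv_add_eq_zero hIopen hpq hs (hd1 s hs) (hd2 s hs)
    rwa [hqq s hs, zero_add] at h
  obtain ⟨s₀, hs₀⟩ := hIne
  have hδ1 : δ = 1 := hδ.resolve_left fun h =>
    not_timelike_of_orthogonal_lightlike (hβ' s₀ hs₀) (hqq s₀ hs₀) (hpq s₀ hs₀)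
      ((hunit s₀ hs₀).trans h)
  subst hδ1
  have h2 : ∀ s ∈ I, deriv β s 2 ≠ 0 := fun s hs =>
    time_ne_zero_of_lightlike (hβ' s hs) (hqq s hs)
  set a : Fin 3 → ℝ := (deriv β s₀ 2)⁻¹ • deriv β s₀ with ha
  have hdir : ∀ s ∈ I, ∀ i, deriv β s i = deriv β s 2 * a i := fun s hs i => by
    have h := eq_of_hasDerivAt_zero hIopen hIconn (g := fun x => deriv β x i / deriv β x 2)
      (fun x hx => by
        have hx' := hasDerivAt_pi.1 (hd2 x hx)
        refine ((hx' i).div (hx' 2) (h2 x hx)).congr_deriv ?_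
        rw [proportional_of_orthogonal_lightlike (hunit x hx) (hpq x hx) (hpr x hx) (hqq x hx)
          (hqr x hx) i, sub_self, zero_div]) hs hs₀
    rw [div_eq_iff (h2 s hs)] at h
    rw [h, ha, Pi.smul_apply, smul_eq_mul]
    ring
  have hline : ∀ s ∈ I, ∀ i, β s i - β s 2 * a i = β s₀ i - β s₀ 2 * a i := fun s hs i =>
    eq_of_hasDerivAt_zero hIopen hIconn (g := fun x => β x i - β x 2 * a i)
      (fun x hx => by
        have hx' := hasDerivAt_pi.1 (hd1 x hx)
        refine ((hx' i).sub ((hx' 2).mul_const (a i))).congr_deriv ?_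
        rw [hdir x hx i, sub_self]) hs hs₀
  have haa : Lprod a a = 0 := by
    have h := hqq s₀ hs₀
    simp only [ha, Lprod, Pi.smul_apply, smul_eq_mul] at h ⊢
    linear_combination (deriv β s₀ 2)⁻¹ ^ 2 * h
  have hpa : Lprod (β s₀) a = 0 := by
    have h := hpq s₀ hs₀
    simp only [ha, Lprod, Pi.smul_apply, smul_eq_mul] at h ⊢
    linear_combination (deriv β s₀ 2)⁻¹ * h
  have hpp := hunit s₀ hs₀
  refine ⟨rfl, hqq, a, β s₀ - β s₀ 2 • a, fun s => β s 2,
    smul_ne_zero (inv_ne_zero (h2 s₀ hs₀)) (hβ' s₀ hs₀), haa, ?_, ?_,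
    contDiffOn_pi.1 hβ 2, fun s hs => ?_, fun s hs => ?_⟩
  · clear_value a
    simp only [Lprod, Pi.sub_apply, Pi.smul_apply, smul_eq_mul] at *
    linear_combination hpa - β s₀ 2 * haa
  · clear_value a
    simp only [Lprod, Pi.sub_apply, Pi.smul_apply, smul_eq_mul] at *
    linear_combination hpp - 2 * β s₀ 2 * hpa + β s₀ 2 ^ 2 * haa
  · rw [(hasDerivAt_pi.1 (hd1 s hs) 2).deriv]
    exact h2 s hs
  · ext i
    simp only [Pi.add_apply, Pi.sub_apply, Pi.smul_apply, smul_eq_mul]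
    linarith [hline s hs i]
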